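/- Fix 0 < q < 1 and an integer n ≥ 1. For α > 0, the q-Bessel polynomial B_n^{(α)}(·;q) has n distinct real zeros x_1(α) < ⋯ < x_n(α), and for each j ∈ {1,...,n} the zero x_j(α) is a strictly decreasing function of α on (0, ∞). -/

import Mathlib

/-- q-Pochhammer symbol `(a;q)_k = ∏_{j=0}^{k-1} (1 - a q^j)`. -/
noncomputable def qpoch (q a : ℝ) (k : ℕ) : ℝ := ∏ j ∈ Finset.range k, (1 - a * q ^ j)

/-- q-Bessel polynomial `B_n^{(α)}(x;q)`. -/
noncomputable def qBesselPoly (q : ℝ) (n : ℕ) (α x : ℝ) : ℝ :=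
  ∑ k ∈ Finset.range (n + 1),
    qpoch q (q ^ (-(n : ℤ))) k * qpoch q (-α * q ^ n) k / qpoch q q k * (q * x) ^ k

open Polynomial Filter Topology

/-- The coefficient `q^{k(k+1)/2} / (q;q)_k` of the orthogonality weight at the grid point `q^k`. -/
noncomputable def qBesselWeight (q : ℝ) (k : ℕ) : ℝ :=
  ∏ j ∈ Finset.range k, (q ^ (j + 1) / (1 - q ^ (j + 1)))

/-- The functional of integration against the orthogonality measure of the q-Bessel polynomials. -/
noncomputable def qBesselFunctional (q α : ℝ) (p : ℝ[X]) : ℝ :=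
  ∑' k, qBesselWeight q k * p.eval (q ^ k) * α ^ k

/-- The `α`-derivative of `qBesselFunctional`. -/
noncomputable def qBesselFunctionalDeriv (q α : ℝ) (p : ℝ[X]) : ℝ :=
  ∑' k : ℕ, qBesselWeight q k * p.eval (q ^ k) * (k * α ^ (k - 1))

section Functional

variable {q : ℝ}

lemma one_sub_pow_succ_pos (hq0 : 0 < q) (hq1 : q < 1) (k : ℕ) : 0 < 1 - q ^ (k + 1) :=
  sub_pos.2 (pow_lt_one₀ hq0.le hq1 k.succ_ne_zero)

lemma qBesselWeight_pos (hq0 : 0 < q) (hq1 : q < 1) (k : ℕ) : 0 < qBesselWeight q k :=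
  Finset.prod_pos fun j _ => div_pos (pow_pos hq0 _) (one_sub_pow_succ_pos hq0 hq1 j)

lemma qBesselWeight_succ_mul (hq0 : 0 < q) (hq1 : q < 1) (k : ℕ) :
    qBesselWeight q (k + 1) * (1 - q ^ (k + 1)) = qBesselWeight q k * q ^ (k + 1) := by
  have := (one_sub_pow_succ_pos hq0 hq1 k).ne'
  rw [qBesselWeight, Finset.prod_range_succ, ← qBesselWeight]
  field_simp

lemma summable_qBesselWeight_mul_pow (hq0 : 0 < q) (hq1 : q < 1) {R : ℝ} (hR : 0 < R) :
    Summable fun k => qBesselWeight q k * R ^ k := by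
  have hpos : ∀ k, 0 < qBesselWeight q k * R ^ k := fun k =>
    mul_pos (qBesselWeight_pos hq0 hq1 k) (pow_pos hR k)
  refine summable_of_ratio_test_tendsto_lt_one (l := 0) zero_lt_one
    (Eventually.of_forall fun k => (hpos k).ne') ?_
  have hq : Tendsto (fun k : ℕ => q ^ (k + 1)) atTop (𝓝 0) :=
    (tendsto_pow_atTop_nhds_zero_of_lt_one hq0.le hq1).comp (tendsto_add_atTop_nat 1)
  have h : Tendsto (fun k : ℕ => q ^ (k + 1) / (1 - q ^ (k + 1)) * R) atTop (𝓝 0) := by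
    simpa using (hq.div (tendsto_const_nhds.sub hq) (by norm_num : (1 : ℝ) - 0 ≠ 0)).mul_const R
  refine h.congr fun k => ?_
  rw [Real.norm_of_nonneg (hpos _).le, Real.norm_of_nonneg (hpos _).le]
  have h1 := (one_sub_pow_succ_pos hq0 hq1 k).ne'
  have h2 := (qBesselWeight_pos hq0 hq1 k).ne'
  have h3 := qBesselWeight_succ_mul hq0 hq1 k
  rw [div_mul_eq_mul_div, div_eq_div_iff h1 (hpos k).ne', pow_succ R]
  linear_combination -(R ^ k * R) * h3

lemma exists_abs_eval_pow_le (hq0 : 0 < q) (hq1 : q < 1) (p : ℝ[X]) :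
    ∃ C, 0 ≤ C ∧ ∀ k : ℕ, |p.eval (q ^ k)| ≤ C := by
  obtain ⟨C, hC⟩ := isCompact_Icc.exists_bound_of_continuousOn
    (p.continuous.continuousOn (s := Set.Icc (0 : ℝ) 1))
  have h : ∀ k : ℕ, |p.eval (q ^ k)| ≤ C := fun k =>
    hC _ ⟨(pow_pos hq0 k).le, pow_le_one₀ hq0.le hq1.le⟩
  exact ⟨C, (abs_nonneg _).trans (h 0), h⟩

lemma summable_qBesselWeight_mul_eval (hq0 : 0 < q) (hq1 : q < 1) (p : ℝ[X]) {R : ℝ}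
    (hR : 0 < R) : Summable fun k : ℕ => |qBesselWeight q k * p.eval (q ^ k)| * (k * R ^ k) := by
  obtain ⟨C, hC0, hC⟩ := exists_abs_eval_pow_le hq0 hq1 p
  refine Summable.of_nonneg_of_le (fun k => by positivity) (fun k => ?_)
    ((summable_qBesselWeight_mul_pow hq0 hq1 (mul_pos two_pos hR)).mul_left C)
  have hk : (k : ℝ) ≤ 2 ^ k := by exact_mod_cast k.lt_two_pow_self.le
  have hw := qBesselWeight_pos hq0 hq1 k
  rw [abs_mul, abs_of_pos hw, mul_pow]
  calc qBesselWeight q k * |p.eval (q ^ k)| * (k * R ^ k)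
      ≤ qBesselWeight q k * C * (2 ^ k * R ^ k) := by gcongr; exact hC k
    _ = C * (qBesselWeight q k * (2 ^ k * R ^ k)) := by ring

lemma summable_qBesselFunctional (hq0 : 0 < q) (hq1 : q < 1) (p : ℝ[X]) (α : ℝ) :
    Summable fun k : ℕ => qBesselWeight q k * p.eval (q ^ k) * α ^ k := by
  obtain ⟨C, hC0, hC⟩ := exists_abs_eval_pow_le hq0 hq1 p
  refine Summable.of_norm_bounded
    ((summable_qBesselWeight_mul_pow hq0 hq1 (R := |α| + 1) (by positivity)).mul_left C)
    fun k => ?_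
  have hw := qBesselWeight_pos hq0 hq1 k
  rw [Real.norm_eq_abs, abs_mul, abs_mul, abs_of_pos hw, abs_pow]
  calc qBesselWeight q k * |p.eval (q ^ k)| * |α| ^ k
      ≤ qBesselWeight q k * C * (|α| + 1) ^ k := by
        gcongr
        · exact hC k
        · linarith
    _ = C * (qBesselWeight q k * (|α| + 1) ^ k) := by ring

lemma abs_natCast_mul_pow_sub_one_le {x R : ℝ} (hR : 1 ≤ R) (hx : |x| ≤ R) (k : ℕ) :
    |(k : ℝ) * x ^ (k - 1)| ≤ k * R ^ k := by
  rw [abs_mul, abs_pow, Nat.abs_cast]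
  gcongr
  calc |x| ^ (k - 1) ≤ R ^ (k - 1) := by gcongr
    _ ≤ R ^ k := pow_le_pow_right₀ hR (Nat.sub_le k 1)

lemma summable_qBesselFunctionalDeriv (hq0 : 0 < q) (hq1 : q < 1) (p : ℝ[X]) (α : ℝ) :
    Summable fun k : ℕ => qBesselWeight q k * p.eval (q ^ k) * (k * α ^ (k - 1)) := by
  refine Summable.of_norm_bounded
    (summable_qBesselWeight_mul_eval hq0 hq1 p (R := |α| + 1) (by positivity)) fun k => ?_
  rw [Real.norm_eq_abs, abs_mul]
  gcongr
  exact abs_natCast_mul_pow_sub_one_le (by linarith [abs_nonneg α]) (by linarith) k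

lemma hasDerivAt_qBesselFunctional (hq0 : 0 < q) (hq1 : q < 1) (p : ℝ[X]) (α : ℝ) :
    HasDerivAt (fun a => qBesselFunctional q a p) (qBesselFunctionalDeriv q α p) α := by
  have hα : α ∈ Metric.ball (0 : ℝ) (|α| + 1) := by simp
  refine hasDerivAt_tsum_of_isPreconnected
    (summable_qBesselWeight_mul_eval hq0 hq1 p (R := |α| + 1) (by positivity))
    Metric.isOpen_ball (convex_ball _ _).isPreconnected
    (fun k y _ => (hasDerivAt_pow k y).const_mul _) (fun k y hy => ?_) hα
    (summable_qBesselFunctional hq0 hq1 p α) hα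
  rw [Real.norm_eq_abs, abs_mul]
  gcongr
  refine abs_natCast_mul_pow_sub_one_le (by linarith [abs_nonneg α]) ?_ k
  simpa using (mem_ball_zero_iff.1 hy).le

lemma qBesselFunctional_add (hq0 : 0 < q) (hq1 : q < 1) (α : ℝ) (p r : ℝ[X]) :
    qBesselFunctional q α (p + r) = qBesselFunctional q α p + qBesselFunctional q α r := by
  rw [qBesselFunctional, qBesselFunctional, qBesselFunctional,
    ← (summable_qBesselFunctional hq0 hq1 p α).tsum_add (summable_qBesselFunctional hq0 hq1 r α)]
  exact tsum_congr fun k => by rw [eval_add]; ring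

lemma qBesselFunctional_C_mul (α c : ℝ) (p : ℝ[X]) :
    qBesselFunctional q α (C c * p) = c * qBesselFunctional q α p := by
  rw [qBesselFunctional, qBesselFunctional, ← tsum_mul_left]
  exact tsum_congr fun k => by rw [eval_mul, eval_C]; ring

lemma qBesselFunctional_sum (hq0 : 0 < q) (hq1 : q < 1) (α : ℝ) {ι : Type*} (s : Finset ι)
    (p : ι → ℝ[X]) :
    qBesselFunctional q α (∑ i ∈ s, p i) = ∑ i ∈ s, qBesselFunctional q α (p i) := by
  classical
  induction s using Finset.induction_on with
  | empty => simp [qBesselFunctional]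
  | insert i s hi ih =>
    rw [Finset.sum_insert hi, Finset.sum_insert hi, qBesselFunctional_add hq0 hq1, ih]

lemma exists_eval_pow_ne_zero (hq0 : 0 < q) (hq1 : q < 1) {p : ℝ[X]} (hp : p ≠ 0) :
    ∃ k : ℕ, p.eval (q ^ k) ≠ 0 := by
  by_contra! h
  refine hp (eq_zero_of_infinite_isRoot p ?_)
  exact (Set.infinite_range_of_injective (pow_right_strictAnti₀ hq0 hq1).injective).mono
    (by rintro _ ⟨k, rfl⟩; exact h k)

lemma qBesselFunctional_pos (hq0 : 0 < q) (hq1 : q < 1) {α : ℝ} (hα : 0 < α) {p : ℝ[X]}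
    (hp : p ≠ 0) (h : ∀ k : ℕ, 0 ≤ p.eval (q ^ k)) : 0 < qBesselFunctional q α p := by
  obtain ⟨k, hk⟩ := exists_eval_pow_ne_zero hq0 hq1 hp
  have hw := qBesselWeight_pos hq0 hq1
  exact (summable_qBesselFunctional hq0 hq1 p α).tsum_pos
    (fun k => mul_nonneg (mul_nonneg (hw k).le (h k)) (pow_pos hα k).le) k
    (mul_pos (mul_pos (hw k) ((h k).lt_of_ne' hk)) (pow_pos hα k))

lemma qBesselFunctional_X_pow (α : ℝ) (m : ℕ) :
    qBesselFunctional q α (X ^ m) = qBesselFunctional q (α * q ^ m) 1 :=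
  tsum_congr fun k => by
    rw [eval_pow, eval_X, eval_one]
    ring

lemma qBesselFunctional_one (hq0 : 0 < q) (hq1 : q < 1) (α : ℝ) :
    qBesselFunctional q α 1 = (1 + α * q) * qBesselFunctional q (α * q) 1 := by
  have h1 := summable_qBesselFunctional hq0 hq1 1 α
  have h2 := summable_qBesselFunctional hq0 hq1 1 (α * q)
  have h : qBesselFunctional q α 1 - qBesselFunctional q (α * q) 1 =
      α * q * qBesselFunctional q (α * q) 1 := by
    rw [qBesselFunctional, qBesselFunctional, ← h1.tsum_sub h2, (h1.sub h2).tsum_eq_zero_add,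
      ← tsum_mul_left]
    simp only [eval_one, pow_zero, mul_one, sub_self, zero_add]
    refine tsum_congr fun k => ?_
    rw [mul_pow, mul_pow]
    linear_combination α ^ (k + 1) * qBesselWeight_succ_mul hq0 hq1 k
  linear_combination h

end Functional

section Orthogonality

variable {q : ℝ}

lemma qpoch_succ (q a : ℝ) (k : ℕ) : qpoch q a (k + 1) = qpoch q a k * (1 - a * q ^ k) :=
  Finset.prod_range_succ _ _

lemma qpoch_self_pos (hq0 : 0 < q) (hq1 : q < 1) (k : ℕ) : 0 < qpoch q q k :=
  Finset.prod_pos fun j _ => by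
    rw [← pow_succ']
    exact one_sub_pow_succ_pos hq0 hq1 j

lemma sum_qpoch_div_eq (hq0 : 0 < q) (hq1 : q < 1) (u z : ℝ) (n : ℕ) :
    (1 - z) * ∑ k ∈ Finset.range n, qpoch q u k / qpoch q q k * z ^ k =
      (1 - u * z) * ∑ k ∈ Finset.range n, qpoch q u k / qpoch q q k * (q * z) ^ k -
        qpoch q u n / qpoch q q n * (1 - q ^ n) * z ^ n := by
  induction n with
  | zero => simp
  | succ n ih =>
    rw [Finset.sum_range_succ, Finset.sum_range_succ, mul_add, ih]
    have h1 := (qpoch_self_pos hq0 hq1 n).ne'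
    have h2 : 1 - q * q ^ n ≠ 0 := by
      rw [← pow_succ']
      exact (one_sub_pow_succ_pos hq0 hq1 n).ne'
    rw [qpoch_succ, qpoch_succ, mul_pow, pow_succ' q]
    field_simp
    ring

lemma qpoch_zpow_neg_succ (hq0 : 0 < q) (n : ℕ) : qpoch q (q ^ (-(n : ℤ))) (n + 1) = 0 := by
  rw [qpoch_succ, zpow_neg, zpow_natCast, inv_mul_cancel₀ (pow_pos hq0 n).ne']
  simp

lemma sum_qpoch_zpow_neg_mul_pow (hq0 : 0 < q) (hq1 : q < 1) {n j : ℕ} (hj : j < n) :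
    ∑ k ∈ Finset.range (n + 1),
      qpoch q (q ^ (-(n : ℤ))) k / qpoch q q k * (q ^ (j + 1)) ^ k = 0 := by
  have key : ∀ i, (1 - q ^ (i + 1)) * ∑ k ∈ Finset.range (n + 1),
      qpoch q (q ^ (-(n : ℤ))) k / qpoch q q k * (q ^ (i + 1)) ^ k =
      (1 - q ^ (-(n : ℤ)) * q ^ (i + 1)) * ∑ k ∈ Finset.range (n + 1),
      qpoch q (q ^ (-(n : ℤ))) k / qpoch q q k * (q ^ (i + 1 + 1)) ^ k := fun i => by
    rw [sum_qpoch_div_eq hq0 hq1, qpoch_zpow_neg_succ hq0, ← pow_succ']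
    ring
  obtain ⟨d, rfl⟩ := Nat.exists_eq_add_of_lt hj
  have h : ∀ e, ∀ i, i + e = j + d → ∑ k ∈ Finset.range (j + d + 1 + 1),
      qpoch q (q ^ (-((j + d + 1 : ℕ) : ℤ))) k / qpoch q q k * (q ^ (i + 1)) ^ k = 0 := by
    intro e
    induction e with
    | zero =>
      intro i hi
      have h1 := key i
      rw [← hi, add_zero, zpow_neg, zpow_natCast,
        inv_mul_cancel₀ (pow_pos hq0 (i + 1)).ne', sub_self, zero_mul] at h1
      rw [← hi, add_zero, zpow_neg, zpow_natCast]
      exact (mul_eq_zero.1 h1).resolve_left (one_sub_pow_succ_pos hq0 hq1 i).ne'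
    | succ e ih =>
      intro i hi
      have h1 := key i
      rw [ih (i + 1) (by omega), mul_zero] at h1
      exact (mul_eq_zero.1 h1).resolve_left (one_sub_pow_succ_pos hq0 hq1 i).ne'
  exact h d j rfl

lemma sum_qpoch_zpow_neg_mul_eval (hq0 : 0 < q) (hq1 : q < 1) {n : ℕ} {p : ℝ[X]}
    (hp : p.natDegree < n) :
    ∑ k ∈ Finset.range (n + 1),
      qpoch q (q ^ (-(n : ℤ))) k / qpoch q q k * q ^ k * p.eval (q ^ k) = 0 := by
  simp_rw [eval_eq_sum_range, Finset.mul_sum]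
  rw [Finset.sum_comm]
  refine Finset.sum_eq_zero fun j hj => ?_
  have hj' : j < n := (Finset.mem_range_succ_iff.1 hj).trans_lt hp
  rw [← mul_zero (p.coeff j), ← sum_qpoch_zpow_neg_mul_pow hq0 hq1 hj', Finset.mul_sum]
  refine Finset.sum_congr rfl fun k _ => ?_
  ring

/-- The q-Bessel polynomial as an element of `ℝ[X]`. -/
noncomputable def qBessel (q : ℝ) (n : ℕ) (α : ℝ) : ℝ[X] :=
  ∑ k ∈ Finset.range (n + 1), C (qpoch q (q ^ (-(n : ℤ))) k / qpoch q q k * q ^ k *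
    qpoch q (-α * q ^ n) k) * X ^ k

/-- The coefficientwise derivative of `qBessel` in the parameter. -/
noncomputable def qBesselDeriv (q : ℝ) (n : ℕ) (α : ℝ) : ℝ[X] :=
  ∑ k ∈ Finset.range (n + 1), C (qpoch q (q ^ (-(n : ℤ))) k / qpoch q q k * q ^ k *
    deriv (fun a => qpoch q (-a * q ^ n) k) α) * X ^ k

lemma eval_qBessel (n : ℕ) (α x : ℝ) : (qBessel q n α).eval x = qBesselPoly q n α x := by
  rw [qBessel, qBesselPoly, eval_finsetSum]
  refine Finset.sum_congr rfl fun k _ => ?_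
  rw [eval_mul, eval_C, eval_pow, eval_X, mul_pow]
  ring

lemma hasDerivAt_qpoch (n k : ℕ) (α : ℝ) :
    HasDerivAt (fun a => qpoch q (-a * q ^ n) k) (deriv (fun a => qpoch q (-a * q ^ n) k) α) α := by
  refine DifferentiableAt.hasDerivAt ?_
  unfold qpoch
  fun_prop

lemma hasDerivAt_eval_qBessel (n : ℕ) (α x : ℝ) :
    HasDerivAt (fun a => (qBessel q n a).eval x) ((qBesselDeriv q n α).eval x) α := by
  simp only [qBessel, qBesselDeriv, eval_finsetSum, eval_mul, eval_C, eval_pow, eval_X]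
  exact HasDerivAt.fun_sum fun k _ => ((hasDerivAt_qpoch n k α).const_mul _).mul_const _

lemma natDegree_qBessel_le (n : ℕ) (α : ℝ) : (qBessel q n α).natDegree ≤ n :=
  natDegree_sum_le_of_forall_le _ _ fun _ hk =>
    (natDegree_C_mul_X_pow_le _ _).trans (Finset.mem_range_succ_iff.1 hk)

lemma natDegree_qBesselDeriv_le (n : ℕ) (α : ℝ) : (qBesselDeriv q n α).natDegree ≤ n :=
  natDegree_sum_le_of_forall_le _ _ fun _ hk =>
    (natDegree_C_mul_X_pow_le _ _).trans (Finset.mem_range_succ_iff.1 hk)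

lemma qBessel_ne_zero (n : ℕ) (α : ℝ) : qBessel q n α ≠ 0 := by
  intro h
  have h0 : qBesselPoly q n α 0 = 0 := by rw [← eval_qBessel, h, eval_zero]
  rw [qBesselPoly, Finset.sum_range_succ'] at h0
  simp [qpoch] at h0

lemma qpoch_mul_qBesselFunctional_one (hq0 : 0 < q) (hq1 : q < 1) (α : ℝ) (n k : ℕ) :
    qpoch q (-α * q ^ (n + 1)) k * qBesselFunctional q (α * q ^ (n + k)) 1 =
      qBesselFunctional q (α * q ^ n) 1 := by
  induction k with
  | zero => simp [qpoch]
  | succ k ih =>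
    rw [← ih, qpoch_succ, qBesselFunctional_one hq0 hq1 (α * q ^ (n + k)), mul_assoc α,
      ← pow_succ, ← add_assoc]
    ring

lemma exists_qBesselFunctional_one_eq (hq0 : 0 < q) (hq1 : q < 1) (α : ℝ) (d : ℕ) :
    ∀ m, ∃ r : ℝ[X], r.natDegree ≤ d ∧ ∀ k, qBesselFunctional q (α * q ^ (m + k)) 1 =
      r.eval (q ^ k) * qBesselFunctional q (α * q ^ (m + d + k)) 1 := by
  induction d with
  | zero => exact fun m => ⟨1, by simp, by simp⟩
  | succ d ih =>
    intro m
    obtain ⟨r, hr, h⟩ := ih (m + 1)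
    refine ⟨(1 + C (α * q ^ (m + 1)) * X) * r, ?_, fun k => ?_⟩
    · refine natDegree_mul_le.trans ?_
      have : (1 + C (α * q ^ (m + 1)) * X).natDegree ≤ 1 := by compute_degree
      omega
    · rw [qBesselFunctional_one hq0 hq1, mul_assoc α, ← pow_succ,
        show m + k + 1 = m + 1 + k by ring, h k, show m + 1 + d + k = m + (d + 1) + k by ring]
      simp only [eval_mul, eval_add, eval_one, eval_C, eval_X]
      ring

lemma qBesselFunctional_qBessel_mul_X_pow (hq0 : 0 < q) (hq1 : q < 1) (α : ℝ) {n m : ℕ}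
    (hm : m < n) : qBesselFunctional q α (qBessel q n α * X ^ m) = 0 := by
  obtain ⟨d, rfl⟩ := Nat.exists_eq_add_of_lt hm
  obtain ⟨r, hr, h⟩ := exists_qBesselFunctional_one_eq hq0 hq1 α d m
  rw [qBessel, Finset.sum_mul, qBesselFunctional_sum hq0 hq1,
    ← mul_zero (qBesselFunctional q (α * q ^ (m + d)) 1), ← sum_qpoch_zpow_neg_mul_eval hq0 hq1
      (show r.natDegree < m + d + 1 by omega), Finset.mul_sum]
  refine Finset.sum_congr rfl fun k _ => ?_
  rw [mul_assoc, ← pow_add, qBesselFunctional_C_mul, qBesselFunctional_X_pow, add_comm k m, h k,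
    ← qpoch_mul_qBesselFunctional_one hq0 hq1 α (m + d) k]
  ring

lemma qBesselFunctional_qBessel_mul (hq0 : 0 < q) (hq1 : q < 1) (α : ℝ) {n : ℕ} {g : ℝ[X]}
    (hg : g.natDegree < n) : qBesselFunctional q α (qBessel q n α * g) = 0 := by
  rw [g.as_sum_range_C_mul_X_pow, Finset.mul_sum, qBesselFunctional_sum hq0 hq1]
  refine Finset.sum_eq_zero fun m hm => ?_
  rw [mul_left_comm, qBesselFunctional_C_mul, qBesselFunctional_qBessel_mul_X_pow hq0 hq1 α
    ((Finset.mem_range_succ_iff.1 hm).trans_lt hg), mul_zero]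

lemma qBesselFunctional_qBesselDeriv_mul (hq0 : 0 < q) (hq1 : q < 1) (α : ℝ) {n : ℕ} {g : ℝ[X]}
    (hg : g.natDegree < n) : qBesselFunctional q α (qBesselDeriv q n α * g) =
      -qBesselFunctionalDeriv q α (qBessel q n α * g) := by
  have expand : ∀ a b, qBesselFunctional q a (qBessel q n b * g) =
      ∑ k ∈ Finset.range (n + 1), qpoch q (q ^ (-(n : ℤ))) k / qpoch q q k * q ^ k *
        qpoch q (-b * q ^ n) k * qBesselFunctional q a (X ^ k * g) := fun a b => by
    rw [qBessel, Finset.sum_mul, qBesselFunctional_sum hq0 hq1]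
    exact Finset.sum_congr rfl fun k _ => by rw [mul_assoc, qBesselFunctional_C_mul]
  have h1 : HasDerivAt (fun a => qBesselFunctional q a (qBessel q n α * g) + ∑ k ∈
      Finset.range (n + 1), qpoch q (q ^ (-(n : ℤ))) k / qpoch q q k * q ^ k *
        (qpoch q (-a * q ^ n) k - qpoch q (-α * q ^ n) k) * qBesselFunctional q a (X ^ k * g))
      (qBesselFunctionalDeriv q α (qBessel q n α * g) +
        qBesselFunctional q α (qBesselDeriv q n α * g)) α := by
    refine (hasDerivAt_qBesselFunctional hq0 hq1 _ α).add ?_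
    rw [qBesselDeriv, Finset.sum_mul, qBesselFunctional_sum hq0 hq1]
    refine HasDerivAt.fun_sum fun k _ => ?_
    refine ((((hasDerivAt_qpoch (q := q) n k α).sub_const (qpoch q (-α * q ^ n) k)).const_mul
      (qpoch q (q ^ (-(n : ℤ))) k / qpoch q q k * q ^ k)).fun_mul
      (hasDerivAt_qBesselFunctional hq0 hq1 (X ^ k * g) α)).congr_deriv ?_
    rw [mul_assoc (C _), qBesselFunctional_C_mul]
    ring
  have h2 : HasDerivAt (fun _ : ℝ => (0 : ℝ)) (qBesselFunctionalDeriv q α (qBessel q n α * g) +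
        qBesselFunctional q α (qBesselDeriv q n α * g)) α := by
    convert h1 using 1
    funext a
    rw [← qBesselFunctional_qBessel_mul hq0 hq1 a hg, expand, expand, ← Finset.sum_add_distrib]
    exact Finset.sum_congr rfl fun k _ => by ring
  linarith [h2.unique (hasDerivAt_const α (0 : ℝ))]

end Orthogonality

section Zeros

lemma exists_isRoot_of_eval_neg_of_eval_pos {p : ℝ[X]} {a b : ℝ} (ha : p.eval a < 0)
    (hb : 0 < p.eval b) : ∃ t ∈ Set.uIcc a b, p.IsRoot t := by
  obtain ⟨t, ht, h⟩ := intermediate_value_uIcc (p.continuous.continuousOn (s := Set.uIcc a b))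
    (Set.mem_uIcc.2 (Or.inl ⟨ha.le, hb.le⟩))
  exact ⟨t, ht, h⟩

/-- Multiplying by the linear factors of the real roots of odd multiplicity gives a polynomial of
constant sign. -/
lemma exists_finset_isRoot_mul_prod_nonneg (d : ℕ) : ∀ p : ℝ[X], p ≠ 0 → p.natDegree = d →
    ∃ S : Finset ℝ, (∀ s ∈ S, p.IsRoot s) ∧
      ∃ c : ℝ, c ≠ 0 ∧ ∀ x, 0 ≤ c * (p * ∏ s ∈ S, (X - C s)).eval x := by
  induction d with
  | zero =>
    intro p hp hd
    obtain ⟨c, rfl⟩ := natDegree_eq_zero.1 hd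
    refine ⟨∅, by simp, c, fun h => hp (by simp [h]), fun x => ?_⟩
    simpa using mul_self_nonneg c
  | succ d ih =>
    intro p hp hd
    by_cases hr : ∃ a, p.IsRoot a
    · obtain ⟨a, ha⟩ := hr
      obtain ⟨r, rfl⟩ := dvd_iff_isRoot.2 ha
      have hr0 : r ≠ 0 := right_ne_zero_of_mul hp
      rw [natDegree_mul (X_sub_C_ne_zero a) hr0, natDegree_X_sub_C] at hd
      obtain ⟨S, hS, c, hc, h⟩ := ih r hr0 (by omega)
      by_cases haS : a ∈ S
      · refine ⟨S.erase a, fun s hs => root_mul_left_of_isRoot _ (hS s (Finset.mem_of_mem_erase hs)),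
          c, hc, fun x => ?_⟩
        rw [mul_comm (X - C a), mul_assoc, Finset.mul_prod_erase S (fun s => X - C s) haS]
        exact h x
      · refine ⟨insert a S, fun s hs => ?_, c, hc, fun x => ?_⟩
        · rcases Finset.mem_insert.1 hs with rfl | hs
          · exact ha
          · exact root_mul_left_of_isRoot _ (hS s hs)
        · rw [Finset.prod_insert haS]
          have := mul_nonneg (sq_nonneg ((X - C a).eval x)) (h x)
          simp only [eval_mul] at this ⊢
          linarith
    · refine ⟨∅, by simp, ?_⟩
      push Not at hr
      by_cases hpos : ∀ x, 0 ≤ p.eval x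
      · exact ⟨1, one_ne_zero, by simpa using hpos⟩
      · push Not at hpos
        obtain ⟨a, ha⟩ := hpos
        refine ⟨-1, by norm_num, fun x => ?_⟩
        by_contra! hx
        obtain ⟨t, -, ht⟩ := exists_isRoot_of_eval_neg_of_eval_pos ha (b := x) (by simpa using hx)
        exact hr t ht

variable {q : ℝ}

lemma card_roots_toFinset_qBessel (hq0 : 0 < q) (hq1 : q < 1) {α : ℝ} (hα : 0 < α) (n : ℕ) :
    (qBessel q n α).roots.toFinset.card = n := by
  have hP := qBessel_ne_zero (q := q) n α
  refine le_antisymm ((Multiset.toFinset_card_le _).trans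
    ((card_roots' _).trans (natDegree_qBessel_le n α))) ?_
  obtain ⟨S, hS, c, hc, h⟩ := exists_finset_isRoot_mul_prod_nonneg _ _ hP rfl
  have hsub : S ⊆ (qBessel q n α).roots.toFinset := fun s hs =>
    Multiset.mem_toFinset.2 ((mem_roots hP).2 (hS s hs))
  refine le_trans ?_ (Finset.card_le_card hsub)
  by_contra! hlt
  have hpos : 0 < qBesselFunctional q α (C c * (qBessel q n α * ∏ s ∈ S, (X - C s))) := by
    refine qBesselFunctional_pos hq0 hq1 hα (mul_ne_zero (C_ne_zero.2 hc) (mul_ne_zero hP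
      (Finset.prod_ne_zero_iff.2 fun s _ => X_sub_C_ne_zero s))) fun k => ?_
    rw [eval_mul, eval_C]
    exact h _
  rw [qBesselFunctional_C_mul, qBesselFunctional_qBessel_mul hq0 hq1 α
    (by rwa [natDegree_prod_of_monic _ _ fun s _ => monic_X_sub_C s, Finset.sum_congr rfl
      fun s _ => natDegree_X_sub_C s, Finset.sum_const, smul_eq_mul, mul_one]), mul_zero] at hpos
  exact hpos.false

lemma exists_enum_isRoot_qBessel (hq0 : 0 < q) (hq1 : q < 1) {α : ℝ} (hα : 0 < α) (n : ℕ) :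
    ∃ x : Fin n → ℝ, StrictMono x ∧ ∀ y, (qBessel q n α).IsRoot y ↔ ∃ j, x j = y := by
  have hcard := card_roots_toFinset_qBessel hq0 hq1 hα n
  refine ⟨_, ((qBessel q n α).roots.toFinset.orderEmbOfFin hcard).strictMono, fun y => ?_⟩
  rw [← Set.mem_range, Finset.range_orderEmbOfFin]
  simp [qBessel_ne_zero]

lemma natDegree_lt_of_X_sub_C_mul_le {p : ℝ[X]} {x : ℝ} {n : ℕ} (hn : 1 ≤ n)
    (h : ((X - C x) * p).natDegree ≤ n) : p.natDegree < n := by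
  rcases eq_or_ne p 0 with rfl | hp
  · rw [natDegree_zero]
    omega
  · rw [natDegree_mul (X_sub_C_ne_zero x) hp, natDegree_X_sub_C] at h
    omega

lemma exists_eq_C_add_X_sub_C_mul (p : ℝ[X]) (x : ℝ) :
    ∃ r : ℝ[X], p = C (p.eval x) + (X - C x) * r ∧ ((X - C x) * r).natDegree ≤ p.natDegree := by
  obtain ⟨r, hr⟩ := X_sub_C_dvd_sub_C_eval (a := x) (p := p)
  refine ⟨r, by rw [← hr]; ring, ?_⟩
  rw [← hr, natDegree_sub_C]

/-- The reproducing property at a zero `x` of the q-Bessel polynomial `(X - x) g`. -/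
lemma qBesselFunctional_mul_eq_eval_mul (hq0 : 0 < q) (hq1 : q < 1) (α : ℝ) {n : ℕ} (hn : 1 ≤ n)
    {x : ℝ} {g p : ℝ[X]} (hg : qBessel q n α = (X - C x) * g) (hp : p.natDegree ≤ n) :
    qBesselFunctional q α (p * g) = p.eval x * qBesselFunctional q α g := by
  obtain ⟨r, hr, hrn⟩ := exists_eq_C_add_X_sub_C_mul p x
  have hr' := natDegree_lt_of_X_sub_C_mul_le hn (hrn.trans hp)
  have h : p * g = C (p.eval x) * g + qBessel q n α * r := by
    rw [hg]
    nth_rewrite 1 [hr]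
    ring
  rw [h, qBesselFunctional_add hq0 hq1, qBesselFunctional_C_mul,
    qBesselFunctional_qBessel_mul hq0 hq1 α hr', add_zero]

lemma pos_of_qBessel_isRoot (hq0 : 0 < q) (hq1 : q < 1) {α : ℝ} (hα : 0 < α) {n : ℕ} (hn : 1 ≤ n)
    {x : ℝ} {g : ℝ[X]} (hg : qBessel q n α = (X - C x) * g) : 0 < x := by
  by_contra! hx
  have hP := qBessel_ne_zero (q := q) n α
  have hg0 : g ≠ 0 := by
    rintro rfl
    exact hP (by rw [hg, mul_zero])
  have hpos := qBesselFunctional_pos hq0 hq1 hα (mul_ne_zero hP hg0) fun k => by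
    rw [hg, mul_assoc, eval_mul, eval_mul, eval_sub, eval_X, eval_C]
    exact mul_nonneg (by linarith [pow_pos hq0 k]) (mul_self_nonneg _)
  rw [qBesselFunctional_qBessel_mul hq0 hq1 α
    (natDegree_lt_of_X_sub_C_mul_le hn (hg ▸ natDegree_qBessel_le n α))] at hpos
  exact hpos.false

lemma qBesselFunctionalDeriv_neg (hq0 : 0 < q) (hq1 : q < 1) {α : ℝ} (hα : 0 < α) {n : ℕ}
    (hn : 1 ≤ n) {x : ℝ} {g : ℝ[X]} (hg : qBessel q n α = (X - C x) * g) :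
    qBesselFunctionalDeriv q α (qBessel q n α * g) < 0 := by
  have hx := pos_of_qBessel_isRoot hq0 hq1 hα hn hg
  have hP := qBessel_ne_zero (q := q) n α
  have hw := qBesselWeight_pos hq0 hq1
  have horth := qBesselFunctional_qBessel_mul hq0 hq1 α
    (natDegree_lt_of_X_sub_C_mul_le hn (hg ▸ natDegree_qBessel_le n α))
  have hs1 := (summable_qBesselFunctionalDeriv hq0 hq1 (qBessel q n α * g) α).mul_left
    (α * Real.log q)
  have hs2 := (summable_qBesselFunctional hq0 hq1 (qBessel q n α * g) α).mul_left (Real.log x)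
  have hterm : ∀ k : ℕ, α * Real.log q *
      (qBesselWeight q k * (qBessel q n α * g).eval (q ^ k) * (k * α ^ (k - 1))) -
      Real.log x * (qBesselWeight q k * (qBessel q n α * g).eval (q ^ k) * α ^ k) =
      qBesselWeight q k * α ^ k * (((Real.log (q ^ k) - Real.log x) * (q ^ k - x)) *
        (g.eval (q ^ k)) ^ 2) := fun k => by
    have hk : (k : ℝ) * α ^ (k - 1) * α = k * α ^ k := by
      rcases k with _ | k
      · simp
      · rw [Nat.add_sub_cancel, mul_assoc, ← pow_succ]
    rw [hg, eval_mul, eval_mul, eval_sub, eval_X, eval_C, Real.log_pow]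
    linear_combination Real.log q * qBesselWeight q k * ((q ^ k - x) * g.eval (q ^ k) ^ 2) * hk
  have hlog : ∀ k : ℕ, 0 ≤ (Real.log (q ^ k) - Real.log x) * (q ^ k - x) := fun k => by
    rcases le_total (q ^ k) x with h | h
    · exact mul_nonneg_of_nonpos_of_nonpos
        (sub_nonpos.2 (Real.log_le_log (pow_pos hq0 k) h)) (sub_nonpos.2 h)
    · exact mul_nonneg (sub_nonneg.2 (Real.log_le_log hx h)) (sub_nonneg.2 h)
  obtain ⟨k, hk⟩ := exists_eval_pow_ne_zero hq0 hq1 hP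
  rw [hg, eval_mul, eval_sub, eval_X, eval_C] at hk
  have hkx := left_ne_zero_of_mul hk
  have hlogk : Real.log (q ^ k) - Real.log x ≠ 0 := fun h =>
    hkx (sub_eq_zero.2 (Real.log_injOn_pos (pow_pos hq0 k) hx (sub_eq_zero.1 h)))
  have hpos := (hs1.sub hs2).tsum_pos
    (fun k => by
      rw [hterm k]
      exact mul_nonneg (mul_nonneg (hw k).le (pow_pos hα k).le)
        (mul_nonneg (hlog k) (sq_nonneg _))) k
    (by
      rw [hterm k]
      exact mul_pos (mul_pos (hw k) (pow_pos hα k)) (mul_pos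
        ((hlog k).lt_of_ne' (mul_ne_zero hlogk hkx)) (sq_pos_of_ne_zero (right_ne_zero_of_mul hk))))
  rw [hs1.tsum_sub hs2, tsum_mul_left, tsum_mul_left, ← qBesselFunctional, horth, mul_zero,
    sub_zero, ← qBesselFunctionalDeriv] at hpos
  have hneg : α * Real.log q < 0 := mul_neg_of_pos_of_neg hα (Real.log_neg hq0 hq1)
  exact neg_of_mul_pos_right hpos hneg.le

/-- At a zero of the q-Bessel polynomial its parameter derivative has the sign of its
`x`-derivative, the value of the cofactor `g`. -/
lemma eval_qBesselDeriv_mul_eval_pos (hq0 : 0 < q) (hq1 : q < 1) {α : ℝ} (hα : 0 < α) {n : ℕ}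
    (hn : 1 ≤ n) {x : ℝ} {g : ℝ[X]} (hg : qBessel q n α = (X - C x) * g) :
    0 < (qBesselDeriv q n α).eval x * g.eval x := by
  have hgn := natDegree_lt_of_X_sub_C_mul_le hn (hg ▸ natDegree_qBessel_le n α)
  have hg0 : g ≠ 0 := by
    rintro rfl
    exact qBessel_ne_zero (q := q) n α (by rw [hg, mul_zero])
  have h1 : 0 < qBesselFunctional q α (g * g) :=
    qBesselFunctional_pos hq0 hq1 hα (mul_ne_zero hg0 hg0) fun k => by
      rw [eval_mul]
      exact mul_self_nonneg _
  have h2 : 0 < qBesselFunctional q α (qBesselDeriv q n α * g) := by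
    rw [qBesselFunctional_qBesselDeriv_mul hq0 hq1 α hgn]
    exact neg_pos.2 (qBesselFunctionalDeriv_neg hq0 hq1 hα hn hg)
  rw [qBesselFunctional_mul_eq_eval_mul hq0 hq1 α hn hg hgn.le] at h1
  rw [qBesselFunctional_mul_eq_eval_mul hq0 hq1 α hn hg (natDegree_qBesselDeriv_le n α)] at h2
  have h3 := mul_pos h2 h1
  rw [mul_mul_mul_comm] at h3
  exact pos_of_mul_pos_left h3 (mul_self_nonneg _)

end Zeros

section Monotonicity

lemma StrictAntiOn.Ioi_of_eventually_lt {f : ℝ → ℝ} {l : ℝ}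
    (hright : ∀ a, l < a → ∀ᶠ b in 𝓝[>] a, f b < f a)
    (hleft : ∀ a, l < a → ∀ᶠ b in 𝓝[<] a, f a < f b) : StrictAntiOn f (Set.Ioi l) := by
  intro a ha b _ hab
  set S : Set ℝ := {c | c ∈ Set.Ioc a b ∧ ∀ d ∈ Set.Ioc a c, f d < f a} with hS
  have hbdd : BddAbove S := ⟨b, fun c hc => hc.1.2⟩
  obtain ⟨u, hu, hau⟩ := (mem_nhdsGT_iff_exists_Ioo_subset).1 (hright a ha)
  obtain ⟨e, he1, he2⟩ := exists_between (lt_min hab hu)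
  have heS : e ∈ S := ⟨⟨he1, he2.le.trans (min_le_left _ _)⟩, fun d hd =>
    hau ⟨hd.1, hd.2.trans_lt (he2.trans_le (min_le_right _ _))⟩⟩
  set c := sSup S with hc
  have hac : a < c := he1.trans_le (le_csSup hbdd heS)
  have hcb : c ≤ b := csSup_le ⟨e, heS⟩ fun s hs => hs.1.2
  have hlt : ∀ d, a < d → d < c → f d < f a := fun d had hdc => by
    obtain ⟨s, hs, hds⟩ := exists_lt_of_lt_csSup ⟨e, heS⟩ hdc
    exact hs.2 d ⟨had, hds.le⟩
  have hfc : f c < f a := by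
    obtain ⟨v, hv, hvc⟩ := (mem_nhdsLT_iff_exists_Ioo_subset).1 (hleft c (lt_trans ha hac))
    obtain ⟨d, hd1, hd2⟩ := exists_between (max_lt hac hv)
    exact (hvc ⟨(le_max_right _ _).trans_lt hd1, hd2⟩).trans
      (hlt d ((le_max_left _ _).trans_lt hd1) hd2)
  rcases hcb.eq_or_lt with h | h
  · rwa [← h]
  · exfalso
    obtain ⟨w, hw, hcw⟩ := (mem_nhdsGT_iff_exists_Ioo_subset).1 (hright c (lt_trans ha hac))
    obtain ⟨d, hd1, hd2⟩ := exists_between (lt_min h hw)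
    have hdS : d ∈ S := by
      refine ⟨⟨hac.trans hd1, hd2.le.trans (min_le_left _ _)⟩, fun t ht => ?_⟩
      rcases lt_trichotomy t c with htc | rfl | htc
      · exact hlt t ht.1 htc
      · exact hfc
      · exact (hcw ⟨htc, ht.2.trans_lt (hd2.trans_le (min_le_right _ _))⟩).trans hfc
    exact (le_csSup hbdd hdS).not_gt hd1

lemma eq_of_strictMono_of_forall_exists_eq {n : ℕ} {x y : Fin n → ℝ} (hx : StrictMono x)
    (hy : StrictMono y) (h : ∀ i, ∃ j, x j = y i) : y = x := by
  refine (hy.range_inj hx).1 ?_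
  have hsub : Finset.univ.image y ⊆ Finset.univ.image x := fun t ht => by
    obtain ⟨i, -, rfl⟩ := Finset.mem_image.1 ht
    obtain ⟨j, hj⟩ := h i
    exact Finset.mem_image.2 ⟨j, Finset.mem_univ j, hj⟩
  have := Finset.eq_of_subset_of_card_le hsub (by
    rw [Finset.card_image_of_injective _ hx.injective, Finset.card_image_of_injective _ hy.injective])
  simpa using congrArg (fun s : Finset ℝ => (s : Set ℝ)) this

lemma HasDerivAt.eventually_nhdsGT_pos {f : ℝ → ℝ} {f' a : ℝ} (h : HasDerivAt f f' a)
    (hf : 0 < f') (ha : f a = 0) : ∀ᶠ b in 𝓝[>] a, 0 < f b := by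
  have hs := ((hasDerivAt_iff_tendsto_slope.1 h).eventually_const_lt hf).filter_mono
    (nhdsWithin_mono a fun _ hb => (Set.mem_Ioi.1 hb).ne')
  filter_upwards [hs, self_mem_nhdsWithin] with b hb hab
  rw [slope_def_field, ha, sub_zero] at hb
  exact (div_pos_iff_of_pos_right (sub_pos.2 hab)).1 hb

lemma HasDerivAt.eventually_nhdsLT_neg {f : ℝ → ℝ} {f' a : ℝ} (h : HasDerivAt f f' a)
    (hf : 0 < f') (ha : f a = 0) : ∀ᶠ b in 𝓝[<] a, f b < 0 := by
  have hs := ((hasDerivAt_iff_tendsto_slope.1 h).eventually_const_lt hf).filter_mono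
    (nhdsWithin_mono a fun _ hb => (Set.mem_Iio.1 hb).ne)
  filter_upwards [hs, self_mem_nhdsWithin] with b hb hab
  rw [slope_def_field, ha, sub_zero] at hb
  by_contra! hfb
  exact hb.not_ge (div_nonpos_of_nonneg_of_nonpos hfb (sub_nonpos.2 (le_of_lt hab)))

variable {q : ℝ}

lemma eval_cofactor_mul_eval_pos {α : ℝ} {n : ℕ} {x m : ℝ} {g : ℝ[X]}
    (hg : qBessel q n α = (X - C x) * g) (hgx : g.eval x ≠ 0)
    (hm : ∀ t ∈ Set.uIcc m x, (qBessel q n α).IsRoot t → t = x) :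
    0 < g.eval m * g.eval x := by
  have hno : ∀ t ∈ Set.uIcc m x, ¬ g.IsRoot t := fun t ht h => by
    have := hm t ht (hg ▸ root_mul_left_of_isRoot _ h)
    exact hgx (this ▸ h)
  by_contra! hle
  have hgm : g.eval m ≠ 0 := hno m Set.left_mem_uIcc
  rcases mul_neg_iff.1 (hle.lt_of_ne (mul_ne_zero hgm hgx)) with ⟨h1, h2⟩ | ⟨h1, h2⟩
  · obtain ⟨t, ht, h⟩ := exists_isRoot_of_eval_neg_of_eval_pos h2 h1
    exact hno t (Set.uIcc_comm m x ▸ ht) h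
  · obtain ⟨t, ht, h⟩ := exists_isRoot_of_eval_neg_of_eval_pos h1 h2
    exact hno t ht h

lemma exists_isRoot_Ioo_of_mul {p : ℝ[X]} {a b s : ℝ} (hab : a < b)
    (ha : p.eval a * s < 0) (hb : 0 < p.eval b * s) : ∃ t ∈ Set.Ioo a b, p.IsRoot t := by
  obtain ⟨t, ht, h⟩ := intermediate_value_Ioo hab.le
    ((p.continuous.mul_const s).continuousOn (s := Set.Icc a b)) ⟨ha, hb⟩
  exact ⟨t, ht, (mul_eq_zero.1 h).resolve_right (right_ne_zero_of_mul ha.ne)⟩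

lemma eventually_exists_isRoot_qBessel_nhdsGT (hq0 : 0 < q) (hq1 : q < 1) {α : ℝ} (hα : 0 < α)
    {n : ℕ} (hn : 1 ≤ n) {x m : ℝ} (hx : (qBessel q n α).IsRoot x) (hmx : m < x)
    (hm : ∀ t ∈ Set.uIcc m x, (qBessel q n α).IsRoot t → t = x) :
    ∀ᶠ β in 𝓝[>] α, ∃ t ∈ Set.Ioo m x, (qBessel q n β).IsRoot t := by
  obtain ⟨g, hg⟩ := dvd_iff_isRoot.2 hx
  have hpos := eval_qBesselDeriv_mul_eval_pos hq0 hq1 hα hn hg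
  have hgm := eval_cofactor_mul_eval_pos hg (right_ne_zero_of_mul hpos.ne') hm
  have hm0 : (qBessel q n α).eval m * g.eval x < 0 := by
    rw [hg, eval_mul, eval_sub, eval_X, eval_C, mul_assoc]
    exact mul_neg_of_neg_of_pos (sub_neg.2 hmx) hgm
  filter_upwards [((hasDerivAt_eval_qBessel n α x).mul_const (g.eval x)).eventually_nhdsGT_pos hpos
      (by rw [hx.eq_zero, zero_mul]),
    nhdsWithin_le_nhds (((hasDerivAt_eval_qBessel n α m).mul_const
      (g.eval x)).continuousAt.eventually_lt_const hm0)] with β h1 h2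
  exact exists_isRoot_Ioo_of_mul hmx h2 h1

lemma eventually_exists_isRoot_qBessel_nhdsLT (hq0 : 0 < q) (hq1 : q < 1) {α : ℝ} (hα : 0 < α)
    {n : ℕ} (hn : 1 ≤ n) {x m : ℝ} (hx : (qBessel q n α).IsRoot x) (hmx : x < m)
    (hm : ∀ t ∈ Set.uIcc m x, (qBessel q n α).IsRoot t → t = x) :
    ∀ᶠ β in 𝓝[<] α, ∃ t ∈ Set.Ioo x m, (qBessel q n β).IsRoot t := by
  obtain ⟨g, hg⟩ := dvd_iff_isRoot.2 hx
  have hpos := eval_qBesselDeriv_mul_eval_pos hq0 hq1 hα hn hg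
  have hgm := eval_cofactor_mul_eval_pos hg (right_ne_zero_of_mul hpos.ne') hm
  have hm0 : 0 < (qBessel q n α).eval m * g.eval x := by
    rw [hg, eval_mul, eval_sub, eval_X, eval_C, mul_assoc]
    exact mul_pos (sub_pos.2 hmx) hgm
  filter_upwards [((hasDerivAt_eval_qBessel n α x).mul_const (g.eval x)).eventually_nhdsLT_neg hpos
      (by rw [hx.eq_zero, zero_mul]),
    nhdsWithin_le_nhds (((hasDerivAt_eval_qBessel n α m).mul_const
      (g.eval x)).continuousAt.eventually_const_lt hm0)] with β h1 h2
  exact exists_isRoot_Ioo_of_mul hmx h1 h2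

variable {n : ℕ} {x : ℝ → Fin n → ℝ}

lemma eventually_nhdsGT_forall_lt (hq0 : 0 < q) (hq1 : q < 1) (hn : 1 ≤ n)
    (hmono : ∀ α, 0 < α → StrictMono (x α))
    (hroot : ∀ α, 0 < α → ∀ y, (qBessel q n α).IsRoot y ↔ ∃ j, x α j = y) {α : ℝ} (hα : 0 < α) :
    ∀ᶠ β in 𝓝[>] α, ∀ j, x β j < x α j := by
  have hsep : ∀ j, ∃ m < x α j, ∀ i < j, x α i < m := fun j => by
    have h : ∀ᶠ m in 𝓝[<] (x α j), ∀ i, i < j → x α i < m :=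
      eventually_all.2 fun i => eventually_imp_distrib_left.2 fun hij =>
        nhdsWithin_le_nhds (lt_mem_nhds (hmono α hα hij))
    obtain ⟨m, h1, h2⟩ := (h.and self_mem_nhdsWithin).exists
    exact ⟨m, h2, h1⟩
  choose m hmx hm using hsep
  have hev : ∀ᶠ β in 𝓝[>] α, ∀ j, ∃ t ∈ Set.Ioo (m j) (x α j), (qBessel q n β).IsRoot t :=
    eventually_all.2 fun j => eventually_exists_isRoot_qBessel_nhdsGT hq0 hq1 hα hn
      ((hroot α hα _).2 ⟨j, rfl⟩) (hmx j) fun t ht htr => by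
        obtain ⟨i, rfl⟩ := (hroot α hα t).1 htr
        rw [Set.uIcc_of_le (hmx j).le] at ht
        rcases ht.2.eq_or_lt with h | h
        · exact h
        · exact absurd ht.1 (hm j i ((hmono α hα).lt_iff_lt.1 h)).not_ge
  filter_upwards [hev, self_mem_nhdsWithin] with β hβ hαβ
  have hβ0 : 0 < β := hα.trans hαβ
  choose t ht htr using hβ
  have htx : t = x β := eq_of_strictMono_of_forall_exists_eq (hmono β hβ0)
    (fun i j hij => (ht i).2.trans ((hm j i hij).trans (ht j).1))
    fun j => (hroot β hβ0 _).1 (htr j)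
  exact fun j => htx ▸ (ht j).2

lemma eventually_nhdsLT_forall_lt (hq0 : 0 < q) (hq1 : q < 1) (hn : 1 ≤ n)
    (hmono : ∀ α, 0 < α → StrictMono (x α))
    (hroot : ∀ α, 0 < α → ∀ y, (qBessel q n α).IsRoot y ↔ ∃ j, x α j = y) {α : ℝ} (hα : 0 < α) :
    ∀ᶠ β in 𝓝[<] α, ∀ j, x α j < x β j := by
  have hsep : ∀ j, ∃ m > x α j, ∀ i > j, m < x α i := fun j => by
    have h : ∀ᶠ m in 𝓝[>] (x α j), ∀ i, i > j → m < x α i :=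
      eventually_all.2 fun i => eventually_imp_distrib_left.2 fun hij =>
        nhdsWithin_le_nhds (gt_mem_nhds (hmono α hα hij))
    obtain ⟨m, h1, h2⟩ := (h.and self_mem_nhdsWithin).exists
    exact ⟨m, h2, h1⟩
  choose m hmx hm using hsep
  have hev : ∀ᶠ β in 𝓝[<] α, ∀ j, ∃ t ∈ Set.Ioo (x α j) (m j), (qBessel q n β).IsRoot t :=
    eventually_all.2 fun j => eventually_exists_isRoot_qBessel_nhdsLT hq0 hq1 hα hn
      ((hroot α hα _).2 ⟨j, rfl⟩) (hmx j) fun t ht htr => by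
        obtain ⟨i, rfl⟩ := (hroot α hα t).1 htr
        rw [Set.uIcc_of_ge (hmx j).le] at ht
        rcases ht.1.eq_or_lt with h | h
        · exact h.symm
        · exact absurd ht.2 (hm j i ((hmono α hα).lt_iff_lt.1 h)).not_ge
  filter_upwards [hev, nhdsWithin_le_nhds (lt_mem_nhds hα)] with β hβ hβ0
  choose t ht htr using hβ
  have htx : t = x β := eq_of_strictMono_of_forall_exists_eq (hmono β hβ0)
    (fun i j hij => (ht i).2.trans ((hm i j hij).trans (ht j).1))
    fun j => (hroot β hβ0 _).1 (htr j)
  exact fun j => htx ▸ (ht j).1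

end Monotonicity

/-- zeros of q-Bessel polynomials: monotonicity in `α`. -/
theorem stmt_14 (q : ℝ) (hq0 : 0 < q) (hq1 : q < 1) (n : ℕ) (hn : 1 ≤ n) :
    ∃ x : ℝ → Fin n → ℝ,
      (∀ α : ℝ, 0 < α →
        StrictMono (x α) ∧
        (∀ j, qBesselPoly q n α (x α j) = 0) ∧
        (∀ y : ℝ, qBesselPoly q n α y = 0 → ∃ j, y = x α j)) ∧
      (∀ j, StrictAntiOn (fun α => x α j) (Set.Ioi 0)) := by
  choose! x hmono hroot using fun (α : ℝ) (hα : 0 < α) =>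
    exists_enum_isRoot_qBessel hq0 hq1 hα n
  refine ⟨x, fun α hα => ⟨hmono α hα, fun j => ?_, fun y hy => ?_⟩, fun j => ?_⟩
  · rw [← eval_qBessel]
    exact (hroot α hα _).2 ⟨j, rfl⟩
  · rw [← eval_qBessel] at hy
    obtain ⟨j, hj⟩ := (hroot α hα y).1 hy
    exact ⟨j, hj.symm⟩
  · exact StrictAntiOn.Ioi_of_eventually_lt
      (fun α hα => (eventually_nhdsGT_forall_lt hq0 hq1 hn hmono hroot hα).mono fun _ h => h j)
      (fun α hα => (eventually_nhdsLT_forall_lt hq0 hq1 hn hmono hroot hα).mono fun _ h => h j)
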